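/- Let q = 2^r with r ≥ 1 (an even prime power) and set v = 1 + q + q² + q³. Then there exists a v×v matrix W over the real quaternions ℍ, each entry of which is either 0 or a quaternion of norm 1, such that W·W* = (1+q³)·I, where W* is the conjugate transpose; moreover, letting A be the v×v integer (0,1)-support matrix of W (A_{ij} = 1 iff W_{ij} ≠ 0), A commutes with Aᵀ and every off-diagonal entry of A·Aᵀ equals either q³ − q² or q³ − q² + 2. -/

import Mathlib

open Matrix

section Quaternion

open Quaternion

/-- A quaternionic weighing matrix `W` of weight `1 + q ^ 3` together with its support matrix `A`,
which is normal and whose distinct rows have inner products `q ^ 3 - q ^ 2` or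
`q ^ 3 - q ^ 2 + 2`. -/
def IsNormalSupportWeighing {ι : Type*} [Fintype ι] [DecidableEq ι] (q : ℕ)
    (W : Matrix ι ι (Quaternion ℝ)) (A : Matrix ι ι ℤ) : Prop :=
  (∀ i j, W i j = 0 ∨ ‖W i j‖ = 1) ∧
  W * Wᴴ = ((1 + (q : ℝ) ^ 3) : ℝ) • 1 ∧
  (∀ i j, (W i j = 0 → A i j = 0) ∧ (W i j ≠ 0 → A i j = 1)) ∧
  A * Aᵀ = Aᵀ * A ∧
  (∀ i j, i ≠ j →
    (A * Aᵀ) i j = (q : ℤ) ^ 3 - (q : ℤ) ^ 2 ∨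
    (A * Aᵀ) i j = (q : ℤ) ^ 3 - (q : ℤ) ^ 2 + 2)

theorem IsNormalSupportWeighing.submatrix {ι κ : Type*} [Fintype ι] [DecidableEq ι]
    [Fintype κ] [DecidableEq κ] {q : ℕ} {W : Matrix ι ι (Quaternion ℝ)} {A : Matrix ι ι ℤ}
    (h : IsNormalSupportWeighing q W A) (e : κ ≃ ι) :
    IsNormalSupportWeighing q (W.submatrix e e) (A.submatrix e e) := by
  obtain ⟨h1, h2, h3, h4, h5⟩ := h
  refine ⟨fun i j => h1 _ _, ?_, fun i j => h3 _ _, ?_, fun i j hij => ?_⟩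
  · rw [conjTranspose_submatrix, submatrix_mul_equiv, h2]
    ext1 i j
    simp [one_apply]
  · rw [transpose_submatrix, submatrix_mul_equiv, submatrix_mul_equiv, h4]
  · rw [transpose_submatrix, submatrix_mul_equiv]
    exact h5 _ _ (e.injective.ne hij)

/-- A real symmetric weighing matrix of order `15` and weight `9`, supported on the pairs of
intersecting edges of the complete graph on six vertices. -/
def weighing15 : Matrix (Fin 15) (Fin 15) ℤ :=
  !![1, 1, 1, 1, 1, 1, 1, 1, 1, 0, 0, 0, 0, 0, 0;
     1, 1, 1, -1, -1, -1, 0, 0, 0, 1, 1, 1, 0, 0, 0;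
     1, 1, -1, 1, -1, 0, -1, 0, 0, -1, 0, 0, 1, 1, 0;
     1, -1, 1, 1, -1, 0, 0, -1, 0, 0, -1, 0, -1, 0, 1;
     1, -1, -1, -1, 1, 0, 0, 0, 1, 0, 0, 1, 0, 1, 1;
     1, -1, 0, 0, 0, 1, -1, 1, -1, 1, 1, -1, 0, 0, 0;
     1, 0, -1, 0, 0, -1, 1, 1, -1, -1, 0, 0, -1, -1, 0;
     1, 0, 0, -1, 0, 1, 1, -1, -1, 0, -1, 0, 1, 0, -1;
     1, 0, 0, 0, 1, -1, -1, -1, 1, 0, 0, -1, 0, -1, -1;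
     0, 1, -1, 0, 0, 1, -1, 0, 0, 1, -1, 1, -1, -1, 0;
     0, 1, 0, -1, 0, 1, 0, -1, 0, -1, 1, -1, -1, 0, 1;
     0, 1, 0, 0, 1, -1, 0, 0, -1, 1, -1, -1, 0, 1, 1;
     0, 0, 1, -1, 0, 0, -1, 1, 0, -1, -1, 0, 1, -1, 1;
     0, 0, 1, 0, 1, 0, -1, 0, -1, -1, 0, 1, -1, 1, -1;
     0, 0, 0, 1, 1, 0, 0, -1, -1, 0, 1, 1, 1, -1, 1]

theorem isNormalSupportWeighing_weighing15 :
    IsNormalSupportWeighing 2 (weighing15.map (Int.cast : ℤ → Quaternion ℝ))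
      (weighing15.map fun a => a ^ 2) := by
  have hW (i j) : weighing15 i j = 0 ∨ weighing15 i j = 1 ∨ weighing15 i j = -1 := by
    have h : ∀ p : Fin 15 × Fin 15, weighing15 p.1 p.2 = 0 ∨ weighing15 p.1 p.2 = 1 ∨
        weighing15 p.1 p.2 = -1 := by decide +kernel
    exact h (i, j)
  have hmul : weighing15 * weighing15ᵀ = diagonal fun _ => 9 := by decide +kernel
  refine ⟨fun i j => ?_, ?_, fun i j => ?_, ?_, ?_⟩
  · rcases hW i j with h | h | h <;> simp [h]
  · have hct : (weighing15.map (Int.cast : ℤ → Quaternion ℝ))ᴴ =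
        weighing15ᵀ.map (Int.cast : ℤ → Quaternion ℝ) := by
      ext1 i j
      simp
    have h := congrArg (fun M => M.map (Int.castRingHom (Quaternion ℝ))) hmul
    simp only [Matrix.map_mul] at h
    rw [hct]
    refine h.trans ?_
    ext1 i j
    by_cases hij : i = j
    · subst hij
      rw [Matrix.smul_apply, one_apply_eq, map_apply, diagonal_apply_eq,
        ← Algebra.algebraMap_eq_smul_one, map_ofNat,
        show (1 + ((2 : ℕ) : ℝ) ^ 3) = 9 by norm_num, map_ofNat]
    · simp [hij]
  · rcases hW i j with h | h | h <;> simp [h]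
  · decide +kernel
  · decide +kernel

section Counting

open Projectivization
open scoped LinearAlgebra.Projectivization

variable {F V R : Type*} [Field F] [AddCommGroup V] [Module F V]

theorem surjective_prod_of_ne {B : V →ₗ[F] V →ₗ[F] F} (hB : ∀ x, B x = 0 → x = 0) {p p' : ℙ F V}
    (hp : p ≠ p') : Function.Surjective ((B p.rep).prod (B p'.rep)) := by
  have key {p p' : ℙ F V} (hp : p ≠ p') : ∃ y, B p.rep y = 1 ∧ B p'.rep y = 0 := by
    by_contra! hne
    have hker : ∀ y, B p'.rep y = 0 → B p.rep y = 0 := fun y hy => by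
      by_contra hy'
      exact hne ((B p.rep y)⁻¹ • y) (by simp [hy']) (by simp [hy])
    have hmem : B p.rep ∈ Submodule.span F (Set.range fun _ : Unit => B p'.rep) :=
      mem_span_of_iInf_ker_le_ker (by
        intro y hy
        simpa using hker y (by simpa using hy))
    rw [Set.range_const, Submodule.mem_span_singleton] at hmem
    obtain ⟨c, hc⟩ := hmem
    have hx : c • p'.rep = p.rep :=
      sub_eq_zero.1 (hB _ (by rw [map_sub, map_smul, hc, sub_self]))
    refine hp ?_
    rw [← p.mk_rep, ← p'.mk_rep, mk_eq_mk_iff']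
    exact ⟨c, hx⟩
  rintro ⟨a, b⟩
  obtain ⟨y, hy, hy'⟩ := key hp
  obtain ⟨z, hz, hz'⟩ := key hp.symm
  exact ⟨a • y + b • z, by simp [hy, hy', hz, hz']⟩

theorem surjective_of_rep {B : V →ₗ[F] V →ₗ[F] F} (hB : ∀ x, B x = 0 → x = 0) (p : ℙ F V) :
    Function.Surjective (B p.rep) :=
  LinearMap.surjective fun h => p.rep_nonzero (hB _ h)

variable [Fintype F] [Fintype V]

theorem sum_eq_card_sub_one_mul_sum_rep [Fintype (ℙ F V)] [CommRing R] (f : V → R) (h0 : f 0 = 0)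
    (hf : ∀ (c : Fˣ) v, f (c • v) = f v) :
    ∑ v, f v = ((Fintype.card F : R) - 1) * ∑ p : ℙ F V, f p.rep := by
  classical
  let φ : ℙ F V × Fˣ → {v : V // v ≠ 0} := fun x =>
    ⟨x.2 • x.1.rep, (smul_ne_zero_iff_ne x.2).2 x.1.rep_nonzero⟩
  have hφ : Function.Bijective φ := by
    constructor
    · rintro ⟨p, c⟩ ⟨p', c'⟩ h
      have h' : c • p.rep = c' • p'.rep := congrArg Subtype.val h
      have hp : p = p' := by
        rw [← p.mk_rep, ← p'.mk_rep, mk_eq_mk_iff]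
        exact ⟨c⁻¹ * c', by rw [mul_smul, ← h', inv_smul_smul]⟩
      subst hp
      rw [Units.smul_def, Units.smul_def] at h'
      have := smul_left_injective F p.rep_nonzero h'
      rw [Units.ext this]
    · rintro ⟨v, hv⟩
      obtain ⟨a, ha⟩ := exists_smul_eq_mk_rep F v hv
      exact ⟨(mk F v hv, a⁻¹), Subtype.ext (by simp [φ, ← ha])⟩
  have h1 : ∑ v, f v = ∑ v : {v : V // v ≠ 0}, f v := by
    rw [← Finset.sum_subtype {v : V | v ≠ 0} (by simp) f]
    exact (Finset.sum_filter_of_ne fun v _ hv => by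
      rintro rfl
      exact hv h0).symm
  rw [h1, ← Function.Bijective.sum_comp hφ (fun v => f v.1), Fintype.sum_prod_type]
  have hc : ((Fintype.card Fˣ : ℕ) : R) = (Fintype.card F : R) - 1 := by
    rw [Fintype.card_units, Nat.cast_sub Fintype.card_pos, Nat.cast_one]
  simp [φ, hf, hc, Finset.mul_sum]

theorem card_sub_one_ne_zero (F : Type*) [Field F] [Fintype F] [CommRing R] [CharZero R] :
    (Fintype.card F : R) - 1 ≠ 0 :=
  sub_ne_zero.2 (Nat.cast_ne_one.2 Fintype.one_lt_card.ne')

theorem sum_ite_eq_zero [DecidableEq F] [CommRing R] :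
    ∑ a : F, (if a = 0 then (0 : R) else 1) = (Fintype.card F : R) - 1 := by
  have h : ∑ a : F, (if a = 0 then (0 : R) else 1) = ∑ a : F, (1 - if a = 0 then (1 : R) else 0) :=
    Finset.sum_congr rfl fun a _ => by split_ifs <;> simp
  rw [h, Finset.sum_sub_distrib]
  simp

theorem card_mul_sum_comp_of_surjective {G H : Type*} [AddCommGroup G] [AddCommGroup H] [Fintype G]
    [Fintype H] [CommRing R] (L : G →+ H) (hL : Function.Surjective L) (g : H → R) :
    (Fintype.card H : R) * ∑ v, g (L v) = (Fintype.card G : R) * ∑ w, g w := by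
  have h (w : H) : ∑ v, g (L v) = ∑ v, g (L v + w) := by
    obtain ⟨u, rfl⟩ := hL w
    rw [← Equiv.sum_comp (Equiv.addRight u)]
    simp
  calc (Fintype.card H : R) * ∑ v, g (L v) = ∑ w : H, ∑ v, g (L v + w) := by
        simp [← h]
    _ = ∑ v, ∑ w : H, g (L v + w) := Finset.sum_comm
    _ = ∑ v : G, ∑ w, g w :=
        Finset.sum_congr rfl fun v _ => Equiv.sum_comp (Equiv.addLeft (L v)) g
    _ = _ := by simp

theorem sum_mul_rep_of_ne [Fintype (ℙ F V)] [CommRing R] [IsDomain R] [CharZero R]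
    (hV : Fintype.card V = Fintype.card F ^ 4) {B : V →ₗ[F] V →ₗ[F] F}
    (hB : ∀ x, B x = 0 → x = 0) {p p' : ℙ F V} (hp : p ≠ p') (u w : F → R) (h0 : u 0 * w 0 = 0)
    (huw : ∀ (c : Fˣ) a b, u (c * a) * w (c * b) = u a * w b) :
    ((Fintype.card F : R) - 1) * ∑ y : ℙ F V, u (B p.rep y.rep) * w (B p'.rep y.rep) =
      (Fintype.card F : R) ^ 2 * ((∑ a, u a) * ∑ a, w a) := by
  rw [← sum_eq_card_sub_one_mul_sum_rep (fun y => u (B p.rep y) * w (B p'.rep y))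
    (by simpa using h0)
    (fun c v => by simpa [Units.smul_def] using huw c _ _)]
  have h := card_mul_sum_comp_of_surjective ((B p.rep).prod (B p'.rep)).toAddMonoidHom
    (surjective_prod_of_ne hB hp) (fun a : F × F => u a.1 * w a.2)
  have hq : (Fintype.card F : R) ≠ 0 := Nat.cast_ne_zero.2 Fintype.card_ne_zero
  simp only [LinearMap.toAddMonoidHom_coe, LinearMap.prod_apply, Function.prod_apply,
    Fintype.card_prod, hV, Nat.cast_mul, Nat.cast_pow, Fintype.sum_prod_type] at h
  rw [Finset.sum_mul_sum]
  refine mul_left_cancel₀ (pow_ne_zero 2 hq) ?_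
  linear_combination h

theorem sum_rep [Fintype (ℙ F V)] [CommRing R] [IsDomain R] [CharZero R]
    (hV : Fintype.card V = Fintype.card F ^ 4) {B : V →ₗ[F] V →ₗ[F] F}
    (hB : ∀ x, B x = 0 → x = 0) (p : ℙ F V) (u : F → R) (h0 : u 0 = 0)
    (hu : ∀ (c : Fˣ) a, u (c * a) = u a) :
    ((Fintype.card F : R) - 1) * ∑ y : ℙ F V, u (B p.rep y.rep) =
      (Fintype.card F : R) ^ 3 * ∑ a, u a := by
  rw [← sum_eq_card_sub_one_mul_sum_rep (fun y => u (B p.rep y)) (by simpa)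
    (fun c v => by simpa [Units.smul_def] using hu c _)]
  have h := card_mul_sum_comp_of_surjective (B p.rep).toAddMonoidHom (surjective_of_rep hB p) u
  have hq : (Fintype.card F : R) ≠ 0 := Nat.cast_ne_zero.2 Fintype.card_ne_zero
  simp only [LinearMap.toAddMonoidHom_coe, hV, Nat.cast_pow] at h
  refine mul_left_cancel₀ hq ?_
  linear_combination h

theorem sum_projectivization_rep_nonzero [Fintype (ℙ F V)] [DecidableEq F] [CommRing R] [IsDomain R]
    [CharZero R] (hV : Fintype.card V = Fintype.card F ^ 4) {B : V →ₗ[F] V →ₗ[F] F}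
    (hB : ∀ x, B x = 0 → x = 0) (p : ℙ F V) :
    ∑ y : ℙ F V, (if B p.rep y.rep = 0 then (0 : R) else 1) = (Fintype.card F : R) ^ 3 := by
  refine mul_left_cancel₀ (card_sub_one_ne_zero F) ?_
  rw [sum_rep hV hB p (fun a => if a = 0 then (0 : R) else 1) (by simp) (by simp),
    sum_ite_eq_zero, mul_comm]

theorem sum_projectivization_rep_nonzero_mul [Fintype (ℙ F V)] [DecidableEq F] [CommRing R]
    [IsDomain R] [CharZero R] (hV : Fintype.card V = Fintype.card F ^ 4) {B : V →ₗ[F] V →ₗ[F] F}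
    (hB : ∀ x, B x = 0 → x = 0) {p p' : ℙ F V} (hp : p ≠ p') :
    ∑ y : ℙ F V, (if B p.rep y.rep = 0 then (0 : R) else 1) *
      (if B p'.rep y.rep = 0 then (0 : R) else 1) =
      (Fintype.card F : R) ^ 3 - (Fintype.card F : R) ^ 2 := by
  refine mul_left_cancel₀ (card_sub_one_ne_zero F) ?_
  rw [sum_mul_rep_of_ne hV hB hp (fun a => if a = 0 then (0 : R) else 1)
    (fun a => if a = 0 then (0 : R) else 1) (by simp) (by simp), sum_ite_eq_zero]
  ring

end Counting

theorem MulChar.norm_apply_of_ne_zero {F : Type*} [Field F] [Fintype F] (χ : MulChar F ℂ) {a : F}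
    (ha : a ≠ 0) : ‖χ a‖ = 1 := by
  classical
  exact Complex.norm_eq_one_of_mem_rootsOfUnity (χ.apply_mem_rootsOfUnity (Units.mk0 a ha))

theorem MulChar.mul_star_apply {F : Type*} [Field F] [Fintype F] [DecidableEq F] (χ : MulChar F ℂ)
    (a : F) : χ a * star (χ a) = if a = 0 then 0 else 1 := by
  split_ifs with h
  · simp [h]
  · rw [Complex.star_def, Complex.mul_conj, Complex.normSq_eq_norm_sq, χ.norm_apply_of_ne_zero h]
    simp

theorem MulChar.exists_ne_one_of_two_lt_card (F : Type*) [Field F] [Fintype F]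
    (h : 2 < Fintype.card F) : ∃ χ : MulChar F ℂ, χ ≠ 1 := by
  obtain ⟨χ, hχ⟩ := MulChar.exists_mulChar_orderOf F dvd_rfl
    (Complex.isPrimitiveRoot_exp (Fintype.card F - 1) (by lia))
  refine ⟨χ, ?_⟩
  rintro rfl
  rw [orderOf_one] at hχ
  lia

section Construction

open scoped LinearAlgebra.Projectivization

/-- The quaternion unit `j`. -/
def unitJ : Quaternion ℝ := ⟨0, 0, 1, 0⟩

@[simp]
theorem re_unitJ : unitJ.re = 0 := rfl

@[simp]
theorem imI_unitJ : unitJ.imI = 0 := rfl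

@[simp]
theorem imJ_unitJ : unitJ.imJ = 1 := rfl

@[simp]
theorem imK_unitJ : unitJ.imK = 0 := rfl

theorem star_unitJ : star unitJ = -unitJ := by
  ext <;> simp

theorem unitJ_mul_unitJ : unitJ * unitJ = -1 := by
  ext <;> simp

theorem norm_unitJ : ‖unitJ‖ = 1 := by
  rw [← sq_eq_sq₀ (norm_nonneg _) zero_le_one, sq, ← Quaternion.normSq_eq_norm_mul_self,
    Quaternion.normSq_def']
  simp

theorem star_ofComplex (z : ℂ) : star (ofComplex z) = ofComplex (star z) := by
  ext <;> simp

theorem unitJ_mul_ofComplex (z : ℂ) : unitJ * ofComplex z = ofComplex (star z) * unitJ := by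
  ext <;> simp

theorem norm_ofComplex (z : ℂ) : ‖ofComplex z‖ = ‖z‖ := by
  rw [← sq_eq_sq₀ (norm_nonneg _) (norm_nonneg _), sq, ← Quaternion.normSq_eq_norm_mul_self,
    Quaternion.normSq_def', ← Complex.normSq_eq_norm_sq, Complex.normSq_apply]
  simp [sq]

theorem mul_conjTranspose_add_smul_one {ι : Type*} [Fintype ι] [DecidableEq ι] {M : Matrix ι ι ℂ}
    (hM : Mᵀ = M) {c : ℝ} (h : M * Mᴴ = (c : ℂ) • 1) :
    (M.map (ofComplex : ℂ → Quaternion ℝ) + diagonal fun _ => unitJ) *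
      (M.map (ofComplex : ℂ → Quaternion ℝ) + diagonal fun _ => unitJ)ᴴ = (1 + c) • 1 := by
  have hC : M.map (ofComplex : ℂ → Quaternion ℝ) * (M.map (ofComplex : ℂ → Quaternion ℝ))ᴴ =
      c • 1 := by
    have hs : (M.map (ofComplex : ℂ → Quaternion ℝ))ᴴ = Mᴴ.map ofComplex := by
      ext1 a b
      simp only [conjTranspose_apply, map_apply, star_ofComplex]
    rw [hs, ← Matrix.map_mul, h]
    ext1 a b
    by_cases hab : a = b <;> ext <;> simp [hab]
  have hcross : M.map (ofComplex : ℂ → Quaternion ℝ) * (diagonal fun _ => unitJ)ᴴ +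
      (diagonal fun _ => unitJ) * (M.map (ofComplex : ℂ → Quaternion ℝ))ᴴ = 0 := by
    ext1 a b
    rw [diagonal_conjTranspose, Matrix.add_apply, mul_diagonal, diagonal_mul, conjTranspose_apply,
      map_apply, map_apply, ← transpose_apply M a b, hM, Pi.star_apply, star_unitJ, star_ofComplex,
      unitJ_mul_ofComplex, star_star, mul_neg, neg_add_cancel, Matrix.zero_apply]
  have hJ : (diagonal fun _ : ι => unitJ) * (diagonal fun _ => unitJ)ᴴ = 1 := by
    rw [diagonal_conjTranspose, diagonal_mul_diagonal, ← diagonal_one]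
    congr 1
    funext a
    rw [Pi.star_apply, star_unitJ, mul_neg, unitJ_mul_unitJ, neg_neg]
  rw [conjTranspose_add, add_mul, mul_add, mul_add, hC, hJ, add_smul, one_smul]
  rw [add_assoc, ← add_assoc _ _ (1 : Matrix ι ι (Quaternion ℝ)), hcross, zero_add, add_comm]

theorem exists_isNormalSupportWeighing_of_alternating {F V : Type*} [Field F] [Fintype F]
    [CharP F 2] [AddCommGroup V] [Module F V] [Fintype V] [Fintype (ℙ F V)] [DecidableEq (ℙ F V)]
    (hF : 2 < Fintype.card F) (hV : Fintype.card V = Fintype.card F ^ 4) (B : V →ₗ[F] V →ₗ[F] F)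
    (hB : ∀ x, B x = 0 → x = 0) (halt : B.IsAlt) :
    ∃ W A, IsNormalSupportWeighing (ι := ℙ F V) (Fintype.card F) W A := by
  classical
  obtain ⟨χ, hχ⟩ := MulChar.exists_ne_one_of_two_lt_card F hF
  have hsymm (x y : V) : B x y = B y x := by rw [← halt.neg, CharTwo.neg_eq]
  let M : Matrix (ℙ F V) (ℙ F V) ℂ := of fun p p' => χ (B p.rep p'.rep)
  let S : Matrix (ℙ F V) (ℙ F V) ℤ := of fun p p' => if B p.rep p'.rep = 0 then 0 else 1
  have hM : Mᵀ = M := by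
    ext1 p p'
    simp [M, hsymm p'.rep]
  have hS : Sᵀ = S := by
    ext1 p p'
    simp [S, hsymm p'.rep]
  have hMM : M * Mᴴ = (((Fintype.card F : ℝ) ^ 3 : ℝ) : ℂ) • 1 := by
    ext1 p p'
    simp only [M, mul_apply, of_apply, conjTranspose_apply]
    by_cases hp : p = p'
    · subst hp
      simp_rw [MulChar.mul_star_apply]
      simp [sum_projectivization_rep_nonzero hV hB p]
    · have h := sum_mul_rep_of_ne hV hB hp (fun a => χ a) (fun a => star (χ a))
        (by rw [χ.map_zero, zero_mul])
        (fun c a b => by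
          have hc := χ.mul_star_apply (c : F)
          rw [if_neg c.ne_zero] at hc
          rw [map_mul, map_mul, star_mul]
          linear_combination χ a * star (χ b) * hc)
      rw [MulChar.sum_eq_zero_of_ne_one hχ, zero_mul, mul_zero] at h
      rw [(mul_eq_zero.1 h).resolve_left (card_sub_one_ne_zero F)]
      simp [hp]
  have hdiag (p : ℙ F V) : B p.rep p.rep = 0 := halt _
  let W : Matrix (ℙ F V) (ℙ F V) (Quaternion ℝ) := M.map ofComplex + diagonal fun _ => unitJ
  have hW (p p' : ℙ F V) :
      W p p' = 0 ∧ (S + 1) p p' = 0 ∨ ‖W p p'‖ = 1 ∧ (S + 1) p p' = 1 := by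
    by_cases hp : p = p'
    · subst hp
      right
      simp [W, M, S, hdiag, norm_unitJ, MulChar.map_zero]
    · by_cases hb : B p.rep p'.rep = 0
      · left
        simp [W, M, S, hp, hb, MulChar.map_zero]
      · right
        simp [W, M, S, hp, hb, norm_ofComplex, χ.norm_apply_of_ne_zero hb, -coe_ofComplex]
  refine ⟨W, S + 1, fun p p' => ?_,
    mul_conjTranspose_add_smul_one hM hMM, fun p p' => ?_, ?_, fun p p' hp => ?_⟩
  · exact (hW p p').imp And.left And.left
  · rcases hW p p' with ⟨h, h'⟩ | ⟨h, h'⟩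
    · exact ⟨fun _ => h', fun h0 => absurd h h0⟩
    · exact ⟨fun h0 => by simp [h0] at h, fun _ => h'⟩
  · rw [transpose_add, transpose_one, hS]
  · have hSS : (S * S) p p' = (Fintype.card F : ℤ) ^ 3 - (Fintype.card F : ℤ) ^ 2 := by
      rw [← sum_projectivization_rep_nonzero_mul hV hB hp, mul_apply]
      refine Finset.sum_congr rfl fun y _ => ?_
      simp only [S, of_apply, hsymm y.rep]
    have hA : ((S + 1) * (S + 1)ᵀ : Matrix (ℙ F V) (ℙ F V) ℤ) p p' = (S * S) p p' + 2 * S p p' := by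
      rw [transpose_add, transpose_one, hS, add_mul, mul_add]
      simp [hp]
      ring
    rw [hA, hSS]
    by_cases hb : B p.rep p'.rep = 0 <;> simp [S, hb]

/-- The standard symplectic form on `F ^ 4`. -/
def symplecticForm (F : Type*) [Field F] : (Fin 4 → F) →ₗ[F] (Fin 4 → F) →ₗ[F] F :=
  LinearMap.mk₂ F (fun x y => x 0 * y 1 - x 1 * y 0 + (x 2 * y 3 - x 3 * y 2))
    (by intros; simp; ring) (by intros; simp; ring) (by intros; simp; ring) (by intros; simp; ring)

theorem symplecticForm_apply {F : Type*} [Field F] (x y : Fin 4 → F) :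
    symplecticForm F x y = x 0 * y 1 - x 1 * y 0 + (x 2 * y 3 - x 3 * y 2) :=
  rfl

theorem symplecticForm_isAlt (F : Type*) [Field F] : (symplecticForm F).IsAlt := fun x => by
  rw [symplecticForm_apply]
  ring

theorem eq_zero_of_symplecticForm_eq_zero {F : Type*} [Field F] (x : Fin 4 → F)
    (hx : symplecticForm F x = 0) : x = 0 := by
  have h (i : Fin 4) : symplecticForm F x (Pi.single i 1) = 0 := by rw [hx]; rfl
  have h0 := h 0
  have h1 := h 1
  have h2 := h 2
  have h3 := h 3
  simp [symplecticForm_apply] at h0 h1 h2 h3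
  ext i
  fin_cases i <;> simpa

end Construction

end Quaternion

theorem stmt3 (r q : ℕ) (hr : 1 ≤ r) (hq : q = 2 ^ r) :
    ∃ W : Matrix (Fin (1 + q + q ^ 2 + q ^ 3)) (Fin (1 + q + q ^ 2 + q ^ 3)) (Quaternion ℝ),
      ∃ A : Matrix (Fin (1 + q + q ^ 2 + q ^ 3)) (Fin (1 + q + q ^ 2 + q ^ 3)) ℤ,
      (∀ i j, W i j = 0 ∨ ‖W i j‖ = 1) ∧
      W * Wᴴ = ((1 + (q : ℝ) ^ 3) : ℝ) • 1 ∧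
      (∀ i j, (W i j = 0 → A i j = 0) ∧ (W i j ≠ 0 → A i j = 1)) ∧
      A * Aᵀ = Aᵀ * A ∧
      (∀ i j, i ≠ j →
        (A * Aᵀ) i j = (q : ℤ) ^ 3 - (q : ℤ) ^ 2 ∨
        (A * Aᵀ) i j = (q : ℤ) ^ 3 - (q : ℤ) ^ 2 + 2) := by
  suffices h : ∃ W A, IsNormalSupportWeighing (ι := Fin (1 + q + q ^ 2 + q ^ 3)) q W A from h
  obtain rfl | hr' := hr.eq_or_lt
  · rw [pow_one] at hq
    subst hq
    exact ⟨_, _, isNormalSupportWeighing_weighing15⟩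
  · let F := GaloisField 2 r
    let : Fintype F := Fintype.ofFinite F
    let : Fintype (Projectivization F (Fin 4 → F)) := Fintype.ofFinite _
    have hF : Fintype.card F = q := by
      rw [Fintype.card_eq_nat_card, GaloisField.card 2 r (by lia), hq]
    have hq2 : 2 < q := by
      rw [hq]
      exact lt_self_pow₀ one_lt_two hr'
    classical
    obtain ⟨W, A, h⟩ := exists_isNormalSupportWeighing_of_alternating (hF ▸ hq2) (by simp)
      (symplecticForm F) eq_zero_of_symplecticForm_eq_zero (symplecticForm_isAlt F)
    have hcard : Fintype.card (Projectivization F (Fin 4 → F)) = 1 + q + q ^ 2 + q ^ 3 := by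
      rw [Fintype.card_eq_nat_card,
        Projectivization.card_of_finrank F (Fin 4 → F) (n := 4) (by simp),
        ← Fintype.card_eq_nat_card, hF]
      simp [Finset.sum_range_succ]
    rw [hF] at h
    exact ⟨_, _, h.submatrix (Fintype.equivFinOfCardEq hcard).symm⟩
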